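/- Let ν > 1/2 be real, and for each n ∈ ℕ let X_n be an almost surely nonnegative random variable (each on its own probability space). Define h_n(t) = 𝔼[F_ν(t·X_n)] for t ≤ 0. Suppose there is a function h : (−∞,0] → ℝ such that h_n(t) → h(t) as n → ∞ for every t ≤ 0, and h is left-continuous at 0 (i.e. h(t) → h(0) as t → 0 from below). Then there exists a probability measure π on ℝ concentrated on [0,∞) such that ∫ F_ν(t·x) dπ(x) = h(t) for all t ≤ 0, and the laws of the X_n converge weakly to π as n → ∞. -/

import Mathlib

open MeasureTheory ProbabilityTheory Filter Topology

/-- The function `F_ν(x) = ∑_{k=0}^∞ x^k/(k!·(ν)_k)`, where `(ν)_k` is the Pochhammer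
symbol. -/
noncomputable def Fnu (ν : ℝ) (x : ℝ) : ℝ :=
  ∑' k : ℕ, x ^ k / (k.factorial * (ascPochhammer ℝ k).eval ν)

lemma half_pow_le_eval_ascPochhammer {ν : ℝ} (hν : 1 / 2 < ν) (k : ℕ) :
    (1 / 2 : ℝ) ^ k ≤ (ascPochhammer ℝ k).eval ν := by
  induction k with
  | zero => simp
  | succ k ih =>
    rw [ascPochhammer_succ_eval, pow_succ]
    have hk : (0 : ℝ) ≤ k := k.cast_nonneg
    exact mul_le_mul ih (by linarith) (by norm_num) (le_trans (by positivity) ih)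

lemma eval_ascPochhammer_pos {ν : ℝ} (hν : 1 / 2 < ν) (k : ℕ) :
    0 < (ascPochhammer ℝ k).eval ν :=
  lt_of_lt_of_le (by positivity) (half_pow_le_eval_ascPochhammer hν k)

lemma eval_ascPochhammer_succ_left (ν : ℝ) (k : ℕ) :
    (ascPochhammer ℝ (k + 1)).eval ν = ν * (ascPochhammer ℝ k).eval (ν + 1) := by
  simp [ascPochhammer_succ_left]

lemma summable_Fnu {ν : ℝ} (hν : 1 / 2 < ν) (x : ℝ) :
    Summable fun k : ℕ => x ^ k / (k.factorial * (ascPochhammer ℝ k).eval ν) := by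
  refine Summable.of_norm_bounded (Real.summable_pow_div_factorial (2 * |x|)) fun k => ?_
  have h1 := half_pow_le_eval_ascPochhammer hν k
  have h2 : (0 : ℝ) < k.factorial := by positivity
  rw [norm_div, norm_pow, Real.norm_eq_abs, Real.norm_eq_abs,
    abs_of_pos (mul_pos h2 (eval_ascPochhammer_pos hν k))]
  calc |x| ^ k / (k.factorial * (ascPochhammer ℝ k).eval ν)
      ≤ |x| ^ k / (k.factorial * (1 / 2 : ℝ) ^ k) := by gcongr
    _ = (2 * |x|) ^ k / k.factorial := by
      rw [mul_pow, one_div, inv_pow]; field_simp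

lemma Fnu_zero (ν : ℝ) : Fnu ν 0 = 1 := by
  rw [Fnu, tsum_eq_single 0]
  · simp
  · intro k hk
    simp [hk]

lemma hasDerivAt_Fnu {ν : ℝ} (hν : 1 / 2 < ν) (x : ℝ) :
    HasDerivAt (Fnu ν) (Fnu (ν + 1) x / ν) x := by
  have hν1 : 1 / 2 < ν + 1 := by linarith
  have hshift (k : ℕ) (y : ℝ) :
      ((k + 1 : ℕ) : ℝ) * y ^ k / ((k + 1).factorial * (ascPochhammer ℝ (k + 1)).eval ν) =
        y ^ k / (k.factorial * (ascPochhammer ℝ k).eval (ν + 1)) / ν := by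
    have h2 := eval_ascPochhammer_pos hν1 k
    rw [eval_ascPochhammer_succ_left, Nat.factorial_succ]
    push_cast
    field_simp
  set R : ℝ := |x| + 1
  have hR : 0 < R := by positivity
  have hsum (y : ℝ) : Summable fun k : ℕ =>
      (k : ℝ) * y ^ (k - 1) / (k.factorial * (ascPochhammer ℝ k).eval ν) := by
    rw [← summable_nat_add_iff 1]
    simp only [Nat.add_sub_cancel, hshift]
    exact (summable_Fnu hν1 y).div_const ν
  have key := hasDerivAt_tsum_of_isPreconnected
    (g := fun (k : ℕ) (y : ℝ) => y ^ k / (k.factorial * (ascPochhammer ℝ k).eval ν))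
    (g' := fun (k : ℕ) (y : ℝ) =>
      (k : ℝ) * y ^ (k - 1) / (k.factorial * (ascPochhammer ℝ k).eval ν))
    (t := Metric.ball 0 R) (y₀ := 0) (y := x) (hsum R) Metric.isOpen_ball
    (convex_ball 0 R).isPreconnected
    (fun k y _ => (hasDerivAt_pow k y).div_const _)
    (fun k y hy => by
      have hy' : |y| ≤ R := by simpa using (Metric.mem_ball.mp hy).le
      have h1 := eval_ascPochhammer_pos hν k
      have h2 : (0 : ℝ) < k.factorial := by positivity
      rw [norm_div, norm_mul, norm_pow, Real.norm_eq_abs, Real.norm_eq_abs, Real.norm_eq_abs,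
        abs_of_pos (mul_pos h2 h1), Nat.abs_cast]
      gcongr)
    (Metric.mem_ball_self hR) (summable_Fnu hν 0) (by simp [R])
  convert! key using 1
  rw [(hsum x).tsum_eq_zero_add]
  simp only [Nat.add_sub_cancel, hshift]
  simp [Fnu, tsum_div_const]

lemma continuous_Fnu {ν : ℝ} (hν : 1 / 2 < ν) : Continuous (Fnu ν) :=
  continuous_iff_continuousAt.mpr fun x => (hasDerivAt_Fnu hν x).continuousAt

lemma Fnu_sub_Fnu_add_one {ν : ℝ} (hν : 1 / 2 < ν) (x : ℝ) :
    Fnu ν x - Fnu (ν + 1) x = x / (ν * (ν + 1)) * Fnu (ν + 2) x := by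
  have hν1 : 1 / 2 < ν + 1 := by linarith
  have hν2 : 1 / 2 < ν + 2 := by linarith
  rw [Fnu, Fnu, Fnu, ← (summable_Fnu hν x).tsum_sub (summable_Fnu hν1 x),
    ((summable_Fnu hν x).sub (summable_Fnu hν1 x)).tsum_eq_zero_add, ← tsum_mul_left]
  simp only [pow_zero, Nat.factorial_zero, ascPochhammer_zero, Polynomial.eval_one, sub_self,
    zero_add]
  refine tsum_congr fun k => ?_
  have h1 := eval_ascPochhammer_pos hν1 k
  have h2 := eval_ascPochhammer_pos hν2 k
  have hk : (0 : ℝ) ≤ k := k.cast_nonneg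
  have h3 : (ascPochhammer ℝ k).eval (ν + 1) * (ν + 1 + k) =
      (ν + 1) * (ascPochhammer ℝ k).eval (ν + 2) := by
    rw [← ascPochhammer_succ_eval, eval_ascPochhammer_succ_left]
    norm_num [add_assoc]
  have h4 : 0 < ν + 1 + k := by linarith
  have h5 : (ascPochhammer ℝ k).eval (ν + 2) =
      (ascPochhammer ℝ k).eval (ν + 1) * (ν + 1 + k) / (ν + 1) := by
    field_simp; linarith
  rw [h5, eval_ascPochhammer_succ_left, ascPochhammer_succ_eval, Nat.factorial_succ]
  push_cast
  field_simp
  ring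

/-- The energy `F_ν² - x F_{ν+1}² / ν²` is nondecreasing, which bounds `F_ν` on `(-∞, 0]`. -/
lemma abs_Fnu_le_one {ν : ℝ} (hν : 1 / 2 < ν) {x : ℝ} (hx : x ≤ 0) : |Fnu ν x| ≤ 1 := by
  have hν1 : 1 / 2 < ν + 1 := by linarith
  have hν0 : 0 < ν := by linarith
  have hderiv (y : ℝ) : HasDerivAt (fun y => Fnu ν y ^ 2 - y * (Fnu (ν + 1) y / ν) ^ 2)
      ((2 * ν - 1) * (Fnu (ν + 1) y / ν) ^ 2) y := by
    have h1 := hasDerivAt_Fnu hν y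
    have h2 := hasDerivAt_Fnu hν1 y
    have h3 := Fnu_sub_Fnu_add_one hν y
    rw [show ν + 1 + 1 = ν + 2 by ring] at h2
    convert! (h1.pow 2).sub ((hasDerivAt_id y).mul ((h2.div_const ν).pow 2)) using 1
    have h4 : Fnu ν y = Fnu (ν + 1) y + y / (ν * (ν + 1)) * Fnu (ν + 2) y := by linarith
    simp only [h4, id, Nat.cast_ofNat, Nat.add_one_sub_one, pow_one, one_mul, Pi.pow_apply]
    field_simp
    ring
  have hmono : Monotone fun y => Fnu ν y ^ 2 - y * (Fnu (ν + 1) y / ν) ^ 2 :=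
    monotone_of_hasDerivAt_nonneg hderiv fun y => by
      have : 0 ≤ 2 * ν - 1 := by linarith
      simp only [Pi.zero_apply]
      positivity
  have h := hmono hx
  simp only [Fnu_zero, zero_mul, sub_zero, one_pow] at h
  rw [← sq_le_one_iff_abs_le_one]
  nlinarith [mul_nonneg (neg_nonneg.mpr hx) (sq_nonneg (Fnu (ν + 1) x / ν))]

section GammaMixture

variable {ν : ℝ}

lemma integral_gammaMeasure (ν : ℝ) (hν : 0 < ν) (f : ℝ → ℝ) :
    ∫ t, f t ∂(gammaMeasure ν 1) =
      ∫ t in Set.Ioi 0, (Real.Gamma ν)⁻¹ * (t ^ (ν - 1) * Real.exp (-t)) * f t := by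
  have hm : Measurable (gammaPDF ν 1) := (measurable_gammaPDFReal ν 1).ennreal_ofReal
  rw [gammaMeasure, integral_withDensity_eq_integral_toReal_smul hm
    (ae_of_all _ fun t => ENNReal.ofReal_lt_top), ← integral_Ici_eq_integral_Ioi,
    ← integral_indicator measurableSet_Ici]
  refine integral_congr_ae (ae_of_all _ fun t => ?_)
  simp only [gammaPDF]
  rw [ENNReal.toReal_ofReal (gammaPDFReal_nonneg hν one_pos t)]
  simp only [smul_eq_mul, Set.indicator, Set.mem_Ici, gammaPDFReal]
  split_ifs <;> simp [mul_assoc]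

lemma ae_gammaMeasure_nonneg (ν : ℝ) : ∀ᵐ t ∂(gammaMeasure ν 1), 0 ≤ t := by
  have hm : Measurable (gammaPDF ν 1) := (measurable_gammaPDFReal ν 1).ennreal_ofReal
  rw [gammaMeasure, ae_withDensity_iff hm]
  refine ae_of_all _ fun t ht => ?_
  by_contra hneg
  exact ht (gammaPDF_of_neg (not_le.mp hneg))

lemma Gamma_add_nat_eq (hν : 1 / 2 < ν) (k : ℕ) :
    Real.Gamma (ν + k) = (ascPochhammer ℝ k).eval ν * Real.Gamma ν := by
  induction k with
  | zero => simp
  | succ k ih =>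
    have hk : (0 : ℝ) ≤ k := k.cast_nonneg
    rw [ascPochhammer_succ_eval, Nat.cast_succ, ← add_assoc, Real.Gamma_add_one (by linarith), ih]
    ring

lemma integral_pow_gammaMeasure (hν : 1 / 2 < ν) (k : ℕ) :
    ∫ t, t ^ k ∂(gammaMeasure ν 1) = (ascPochhammer ℝ k).eval ν := by
  have hν0 : 0 < ν := by linarith
  have hk : (0 : ℝ) ≤ k := k.cast_nonneg
  have hG : Real.Gamma ν ≠ 0 := (Real.Gamma_pos_of_pos hν0).ne'
  have h := Real.integral_rpow_mul_exp_neg_mul_Ioi (a := ν + k) (r := 1) (by linarith) one_pos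
  rw [integral_gammaMeasure ν hν0]
  calc ∫ t in Set.Ioi (0 : ℝ), (Real.Gamma ν)⁻¹ * (t ^ (ν - 1) * Real.exp (-t)) * t ^ k
      = ∫ t in Set.Ioi (0 : ℝ), (Real.Gamma ν)⁻¹ * (t ^ (ν + k - 1) * Real.exp (-(1 * t))) := by
        refine setIntegral_congr_fun measurableSet_Ioi fun t ht => ?_
        rw [show ν + k - 1 = ν - 1 + k by ring, Real.rpow_add ht, Real.rpow_natCast, one_mul]
        ring
    _ = (ascPochhammer ℝ k).eval ν := by
        rw [integral_const_mul, h, Gamma_add_nat_eq hν]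
        simp
        field_simp

lemma integrable_pow_gammaMeasure (hν : 1 / 2 < ν) (k : ℕ) :
    Integrable (fun t => t ^ k) (gammaMeasure ν 1) := by
  by_contra hneg
  have h := integral_pow_gammaMeasure hν k
  rw [integral_undef hneg] at h
  exact (eval_ascPochhammer_pos hν k).ne h

/-- Mixing `F_ν` with a Gamma distribution of shape `ν` produces an exponential. -/
lemma integral_Fnu_gammaMeasure (hν : 1 / 2 < ν) (y : ℝ) :
    ∫ t, Fnu ν (y * t) ∂(gammaMeasure ν 1) = Real.exp y := by
  have hterm (k : ℕ) (t : ℝ) : (y * t) ^ k / (k.factorial * (ascPochhammer ℝ k).eval ν) =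
      y ^ k / (k.factorial * (ascPochhammer ℝ k).eval ν) * t ^ k := by
    rw [mul_pow]; ring
  have hint (k : ℕ) (a : ℝ) : a ^ k / (k.factorial * (ascPochhammer ℝ k).eval ν) *
      (ascPochhammer ℝ k).eval ν = a ^ k / k.factorial := by
    have := eval_ascPochhammer_pos hν k
    field_simp
  have h := hasSum_integral_of_summable_integral_norm (μ := gammaMeasure ν 1)
    (F := fun (k : ℕ) t => (y * t) ^ k / (k.factorial * (ascPochhammer ℝ k).eval ν))
    (fun k => by
      simp only [hterm]
      exact (integrable_pow_gammaMeasure hν k).const_mul _)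
    (by
      refine (Real.summable_pow_div_factorial |y|).congr fun k => ?_
      rw [← hint k |y|, ← integral_pow_gammaMeasure hν k, ← integral_const_mul,
        integral_pow_gammaMeasure hν k]
      refine integral_congr_ae ?_
      filter_upwards [ae_gammaMeasure_nonneg ν] with t ht
      have := eval_ascPochhammer_pos hν k
      rw [hterm, norm_mul, norm_div, norm_pow, norm_pow, Real.norm_of_nonneg ht, norm_mul,
        Real.norm_of_nonneg this.le, Real.norm_natCast, Real.norm_eq_abs])
  have h2 : HasSum (fun k : ℕ => y ^ k / k.factorial) (Real.exp y) := by
    rw [Real.exp_eq_exp_ℝ]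
    exact NormedSpace.expSeries_div_hasSum_exp y
  refine h.unique ?_
  simpa only [hterm, integral_const_mul, integral_pow_gammaMeasure hν, hint] using h2

end GammaMixture

section LaplaceContinuity

open scoped NNReal BoundedContinuousFunction

/-- The function `x ↦ exp (-s x)` on `[0, ∞)`, as a bounded continuous function. -/
noncomputable def expNegBCF (s : ℝ≥0) : ℝ≥0 →ᵇ ℝ :=
  BoundedContinuousFunction.ofNormedAddCommGroup (fun x : ℝ≥0 => Real.exp (-(s * x : ℝ)))
    (by fun_prop) 1 fun x => by
      rw [Real.norm_of_nonneg (Real.exp_pos _).le, Real.exp_le_one_iff]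
      exact neg_nonpos.mpr (by positivity)

@[simp]
lemma expNegBCF_apply (s x : ℝ≥0) : expNegBCF s x = Real.exp (-(s * x : ℝ)) := rfl

lemma expNegBCF_one_pow (n : ℕ) : expNegBCF 1 ^ n = expNegBCF n := by
  ext x
  simp [← Real.exp_nat_mul]

/-- The polynomials in `x ↦ exp (-x)`, as a star subalgebra. -/
noncomputable def expNegSubalgebra : StarSubalgebra ℝ (ℝ≥0 →ᵇ ℝ) :=
  { Algebra.adjoin ℝ {expNegBCF 1} with
    star_mem' := fun {a} ha => by
      have : star a = a := by ext; simp
      rwa [this] }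

lemma expNegBCF_one_mem : expNegBCF 1 ∈ expNegSubalgebra :=
  Algebra.subset_adjoin (Set.mem_singleton _)

lemma separatesPoints_expNegSubalgebra :
    (expNegSubalgebra.map
      (BoundedContinuousFunction.toContinuousMapStarₐ ℝ)).SeparatesPoints := by
  intro x y hxy
  refine ⟨expNegBCF 1, ⟨_, ⟨expNegBCF 1, expNegBCF_one_mem, rfl⟩, rfl⟩, ?_⟩
  simpa using hxy

lemma tendsto_integral_of_mem_expNegSubalgebra {μ : ℕ → ProbabilityMeasure ℝ≥0}
    {μ₀ : ProbabilityMeasure ℝ≥0}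
    (h : ∀ s : ℝ≥0, Tendsto (fun n => ∫ x, expNegBCF s x ∂(μ n : Measure ℝ≥0)) atTop
      (𝓝 (∫ x, expNegBCF s x ∂(μ₀ : Measure ℝ≥0))))
    {g : ℝ≥0 →ᵇ ℝ} (hg : g ∈ expNegSubalgebra) :
    Tendsto (fun n => ∫ x, g x ∂(μ n : Measure ℝ≥0)) atTop
      (𝓝 (∫ x, g x ∂(μ₀ : Measure ℝ≥0))) := by
  change g ∈ Algebra.adjoin ℝ {expNegBCF 1} at hg
  rw [Algebra.adjoin_singleton_eq_range_aeval] at hg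
  obtain ⟨p, rfl⟩ := hg
  simp only [AlgHom.toRingHom_eq_coe, RingHom.coe_coe]
  induction p using Polynomial.induction_on' with
  | add p q hp hq =>
    have key (m : ProbabilityMeasure ℝ≥0) :
        ∫ x, (Polynomial.aeval (expNegBCF 1) (p + q)) x ∂(m : Measure ℝ≥0) =
          ∫ x, (Polynomial.aeval (expNegBCF 1) p) x ∂(m : Measure ℝ≥0) +
            ∫ x, (Polynomial.aeval (expNegBCF 1) q) x ∂(m : Measure ℝ≥0) := by
      rw [map_add]
      exact integral_add (BoundedContinuousFunction.integrable _ _)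
        (BoundedContinuousFunction.integrable _ _)
    simp only [key]
    exact hp.add hq
  | monomial k a =>
    have key (m : ProbabilityMeasure ℝ≥0) :
        ∫ x, (Polynomial.aeval (expNegBCF 1) (Polynomial.monomial k a)) x ∂(m : Measure ℝ≥0) =
          a * ∫ x, expNegBCF k x ∂(m : Measure ℝ≥0) := by
      rw [Polynomial.aeval_monomial, expNegBCF_one_pow, ← integral_const_mul]
      refine integral_congr_ae (ae_of_all _ fun x => ?_)
      simp [Algebra.algebraMap_eq_smul_one]
    simp only [key]
    exact (h k).const_mul a

/-- Markov's inequality for the Laplace transform. -/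
lemma measureReal_compl_Icc_le (μ : ProbabilityMeasure ℝ≥0) {s : ℝ≥0} (hs : 0 < s) :
    (μ : Measure ℝ≥0).real (Set.Icc 0 s⁻¹)ᶜ ≤
      2 * (1 - ∫ x, expNegBCF s x ∂(μ : Measure ℝ≥0)) := by
  have hi : Integrable (fun x => 1 - expNegBCF s x) (μ : Measure ℝ≥0) :=
    (integrable_const 1).sub (BoundedContinuousFunction.integrable _ _)
  have h := mul_meas_ge_le_integral_of_nonneg (μ := (μ : Measure ℝ≥0))
    (f := fun x => 1 - expNegBCF s x) (ae_of_all _ fun x => by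
      simp only [Pi.zero_apply, expNegBCF_apply, sub_nonneg, Real.exp_le_one_iff]
      exact neg_nonpos.mpr (by positivity)) hi (1 / 2)
  rw [integral_sub (integrable_const 1) (BoundedContinuousFunction.integrable _ _)] at h
  simp only [integral_const, probReal_univ, smul_eq_mul, mul_one] at h
  have hsub : (μ : Measure ℝ≥0).real (Set.Icc 0 s⁻¹)ᶜ ≤
      (μ : Measure ℝ≥0).real {x | 1 / 2 ≤ 1 - expNegBCF s x} := by
    refine measureReal_mono fun x hx => ?_
    have hx1 : s⁻¹ < x := by simpa using hx
    have hx2 : (1 : ℝ) < s * x := by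
      have := mul_lt_mul_of_pos_left hx1 hs
      rw [mul_inv_cancel₀ hs.ne'] at this
      exact_mod_cast this
    have hx3 : Real.exp (-(s * x : ℝ)) ≤ Real.exp (-1) :=
      Real.exp_le_exp.mpr (by linarith)
    have := Real.exp_neg_one_lt_half
    simp only [Set.mem_ofPred_eq, expNegBCF_apply]
    linarith
  linarith

lemma isTightMeasureSet_of_tendsto_laplace {μ : ℕ → ProbabilityMeasure ℝ≥0} {φ : ℝ≥0 → ℝ}
    (h : ∀ s, Tendsto (fun n => ∫ x, expNegBCF s x ∂(μ n : Measure ℝ≥0)) atTop (𝓝 (φ s)))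
    (hφ : Tendsto φ (𝓝[>] 0) (𝓝 1)) :
    IsTightMeasureSet {(μ n : Measure ℝ≥0) | n} := by
  rw [isTightMeasureSet_iff_exists_isCompact_measure_compl_le]
  intro ε hε
  obtain ⟨δ, hδ, hδε⟩ : ∃ δ : ℝ≥0, 0 < δ ∧ (δ : ENNReal) < ε :=
    ENNReal.lt_iff_exists_nnreal_btwn.mp hε |>.imp fun δ hδ => ⟨by exact_mod_cast hδ.1, hδ.2⟩
  have hδ' : (0 : ℝ) < δ := hδ
  obtain ⟨s, hsφ, hs⟩ : ∃ s, 1 - (δ : ℝ) / 2 < φ s ∧ 0 < s :=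
    ((hφ.eventually (lt_mem_nhds (by linarith))).and self_mem_nhdsWithin).exists
  obtain ⟨N, hN⟩ := eventually_atTop.mp ((h s).eventually (lt_mem_nhds hsφ))
  have hfin (N : ℕ) : IsTightMeasureSet {m | ∃ n < N, (μ n : Measure ℝ≥0) = m} := by
    induction N with
    | zero =>
      exact (isTightMeasureSet_singleton (μ := (μ 0 : Measure ℝ≥0))).subset (by simp)
    | succ N ih =>
      refine (ih.union (isTightMeasureSet_singleton (μ := (μ N : Measure ℝ≥0)))).subset ?_
      rintro m ⟨n, hn, rfl⟩
      rcases (Nat.lt_succ_iff_lt_or_eq.mp hn) with hn | rfl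
      · exact Or.inl ⟨n, hn, rfl⟩
      · exact Or.inr rfl
  obtain ⟨K, hK, hKε⟩ := isTightMeasureSet_iff_exists_isCompact_measure_compl_le.mp (hfin N) ε hε
  refine ⟨K ∪ Set.Icc 0 s⁻¹, hK.union isCompact_Icc, ?_⟩
  rintro _ ⟨n, rfl⟩
  rcases lt_or_ge n N with hn | hn
  · exact (measure_mono (Set.compl_subset_compl.mpr Set.subset_union_left)).trans
      (hKε _ ⟨n, hn, rfl⟩)
  · refine (measure_mono (Set.compl_subset_compl.mpr Set.subset_union_right)).trans ?_
    refine le_trans ?_ hδε.le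
    rw [← ENNReal.ofReal_coe_nnreal, ← ofReal_measureReal]
    refine ENNReal.ofReal_le_ofReal ((measureReal_compl_Icc_le (μ n) hs).trans ?_)
    linarith [hN n hn]

/-- The continuity theorem for Laplace transforms of probability measures on `[0, ∞)`. -/
theorem exists_tendsto_of_tendsto_laplace {μ : ℕ → ProbabilityMeasure ℝ≥0} {φ : ℝ≥0 → ℝ}
    (h : ∀ s, Tendsto (fun n => ∫ x, expNegBCF s x ∂(μ n : Measure ℝ≥0)) atTop (𝓝 (φ s)))
    (hφ : Tendsto φ (𝓝[>] 0) (𝓝 1)) :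
    ∃ μ₀ : ProbabilityMeasure ℝ≥0, Tendsto μ atTop (𝓝 μ₀) := by
  have htight := isTightMeasureSet_of_tendsto_laplace h hφ
  have hcomp : IsCompact (closure {μ n | n}) :=
    isCompact_closure_of_isTightMeasureSet (by simpa using htight)
  obtain ⟨μ₀, -, hμ₀⟩ := hcomp.ultrafilter_le_nhds ((hyperfilter ℕ).map μ)
    (.trans (by simp) (monotone_principal subset_closure))
  have hlim : Tendsto μ (hyperfilter ℕ) (𝓝 μ₀) := hμ₀
  rw [ProbabilityMeasure.tendsto_iff_forall_integral_tendsto] at hlim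
  have heq (s : ℝ≥0) : φ s = ∫ x, expNegBCF s x ∂(μ₀ : Measure ℝ≥0) :=
    tendsto_nhds_unique ((h s).mono_left Nat.hyperfilter_le_atTop) (hlim _)
  refine ⟨μ₀, ProbabilityMeasure.tendsto_of_tight_of_separatesPoints ℝ htight
    separatesPoints_expNegSubalgebra fun g hg => ?_⟩
  exact tendsto_integral_of_mem_expNegSubalgebra (fun s => heq s ▸ h s) hg

end LaplaceContinuity

section HankelContinuity

open scoped NNReal

variable {ν : ℝ}

lemma integral_integral_Fnu_gammaMeasure (hν : 1 / 2 < ν) (μ : ProbabilityMeasure ℝ≥0)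
    (s : ℝ≥0) :
    ∫ t, ∫ x : ℝ≥0, Fnu ν (-(s * t) * x) ∂(μ : Measure ℝ≥0) ∂(gammaMeasure ν 1) =
      ∫ x, expNegBCF s x ∂(μ : Measure ℝ≥0) := by
  have : IsProbabilityMeasure (gammaMeasure ν 1) :=
    isProbabilityMeasure_gammaMeasure (by linarith) one_pos
  have hF := continuous_Fnu hν
  rw [integral_integral_swap]
  · refine integral_congr_ae (ae_of_all _ fun x => ?_)
    simp only [expNegBCF_apply]
    rw [← integral_Fnu_gammaMeasure hν]
    refine integral_congr_ae (ae_of_all _ fun t => ?_)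
    simp only
    congr 1
    ring
  · refine Integrable.of_bound (C := 1) (by fun_prop) ?_
    filter_upwards [Measure.quasiMeasurePreserving_fst.ae (ae_gammaMeasure_nonneg ν)] with p hp
    refine abs_Fnu_le_one hν ?_
    rw [neg_mul, neg_nonpos]
    positivity

lemma abs_integral_Fnu_le_one (hν : 1 / 2 < ν) (μ : ProbabilityMeasure ℝ≥0) {t : ℝ}
    (ht : t ≤ 0) : |∫ x : ℝ≥0, Fnu ν (t * x) ∂(μ : Measure ℝ≥0)| ≤ 1 := by
  have h := norm_integral_le_of_norm_le_const (μ := (μ : Measure ℝ≥0)) (C := 1)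
    (f := fun x : ℝ≥0 => Fnu ν (t * x))
    (ae_of_all _ fun x => abs_Fnu_le_one hν (mul_nonpos_of_nonpos_of_nonneg ht x.2))
  simpa using h

/-- The continuity theorem for the Hankel transform, for probability measures on `[0, ∞)`. -/
theorem exists_tendsto_of_tendsto_integral_Fnu (hν : 1 / 2 < ν)
    {μ : ℕ → ProbabilityMeasure ℝ≥0} {h : ℝ → ℝ}
    (hconv : ∀ t ≤ (0 : ℝ),
      Tendsto (fun n => ∫ x : ℝ≥0, Fnu ν (t * x) ∂(μ n : Measure ℝ≥0)) atTop (𝓝 (h t)))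
    (hcont : Tendsto h (𝓝[<] 0) (𝓝 (h 0))) :
    ∃ μ₀ : ProbabilityMeasure ℝ≥0, Tendsto μ atTop (𝓝 μ₀) := by
  have hprob : IsProbabilityMeasure (gammaMeasure ν 1) :=
    isProbabilityMeasure_gammaMeasure (by linarith) one_pos
  have hF := continuous_Fnu hν
  have hmeas (m : ProbabilityMeasure ℝ≥0) (s : ℝ≥0) : AEStronglyMeasurable
      (fun t : ℝ => ∫ x : ℝ≥0, Fnu ν (-(s * t) * x) ∂(m : Measure ℝ≥0)) (gammaMeasure ν 1) :=
    (StronglyMeasurable.integral_prod_right (f := fun (t : ℝ) (x : ℝ≥0) => Fnu ν (-(s * t) * x))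
      (Continuous.stronglyMeasurable (by fun_prop))).aestronglyMeasurable
  have hnonpos (s : ℝ≥0) {t : ℝ} (ht : 0 ≤ t) : -(s * t : ℝ) ≤ 0 :=
    neg_nonpos.mpr (by positivity)
  have h0 : h 0 = 1 :=
    tendsto_nhds_unique (hconv 0 le_rfl) (by simp [Fnu_zero])
  have hbound {t : ℝ} (ht : t ≤ 0) : |h t| ≤ 1 :=
    le_of_tendsto (hconv t ht).abs (Eventually.of_forall fun n => abs_integral_Fnu_le_one hν _ ht)
  have hhmeas (s : ℝ≥0) : AEStronglyMeasurable (fun t : ℝ => h (-(s * t))) (gammaMeasure ν 1) := by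
    refine aestronglyMeasurable_of_tendsto_ae atTop (fun n => hmeas (μ n) s) ?_
    filter_upwards [ae_gammaMeasure_nonneg ν] with t ht using hconv _ (hnonpos s ht)
  refine exists_tendsto_of_tendsto_laplace
    (φ := fun s => ∫ t, h (-(s * t)) ∂(gammaMeasure ν 1)) (fun s => ?_) ?_
  · simp only [← integral_integral_Fnu_gammaMeasure hν]
    refine tendsto_integral_of_dominated_convergence (fun _ => 1) (fun n => hmeas (μ n) s)
      (integrable_const 1) (fun n => ?_) ?_
    · filter_upwards [ae_gammaMeasure_nonneg ν] with t ht using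
        abs_integral_Fnu_le_one hν _ (hnonpos s ht)
    · filter_upwards [ae_gammaMeasure_nonneg ν] with t ht using hconv _ (hnonpos s ht)
  · have hle : Tendsto h (𝓝[≤] 0) (𝓝 1) := by
      rw [← h0]
      exact (continuousWithinAt_Iio_iff_Iic (f := h) (a := (0 : ℝ))).mp hcont
    have hone : (1 : ℝ) = ∫ _, (1 : ℝ) ∂(gammaMeasure ν 1) := by simp
    rw [congrArg 𝓝 hone]
    refine tendsto_integral_filter_of_dominated_convergence (fun _ => 1)
      (Eventually.of_forall hhmeas) (Eventually.of_forall fun s => ?_) (integrable_const 1) ?_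
    · filter_upwards [ae_gammaMeasure_nonneg ν] with t ht using hbound (hnonpos s ht)
    · filter_upwards [ae_gammaMeasure_nonneg ν] with t ht
      refine hle.comp (tendsto_nhdsWithin_iff.mpr
        ⟨?_, Eventually.of_forall fun s => hnonpos s ht⟩)
      have hc : Continuous fun s : ℝ≥0 => -(s * t : ℝ) := by fun_prop
      simpa using (hc.tendsto 0).mono_left nhdsWithin_le_nhds

end HankelContinuity

/-- Proposition 4.18 of the paper (Lévy-type continuity theorem for the Hankel
transform): if the transforms `h_n(t) = 𝔼[F_ν(t X_n)]` converge pointwise on `(−∞,0]`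
to a function `h` which is left-continuous at `0`, then there is a probability measure
`π` on `[0,∞)` whose transform is `h` and the laws of the `X_n` converge weakly to
`π`. -/
theorem Fnu_levy_continuity
    (ν : ℝ) (hν : 1 / 2 < ν)
    {Ω : ℕ → Type*} [∀ n, MeasurableSpace (Ω n)]
    (P : ∀ n, Measure (Ω n)) [∀ n, IsProbabilityMeasure (P n)]
    (X : ∀ n, Ω n → ℝ) (hX : ∀ n, Measurable (X n))
    (hXpos : ∀ n, ∀ᵐ ω ∂(P n), 0 ≤ X n ω)
    (h : ℝ → ℝ)
    (hconv : ∀ t ≤ (0 : ℝ),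
      Tendsto (fun n => ∫ ω, Fnu ν (t * X n ω) ∂(P n)) atTop (𝓝 (h t)))
    (hcont : Tendsto h (nhdsWithin 0 (Set.Iio 0)) (𝓝 (h 0))) :
    ∃ π : Measure ℝ, IsProbabilityMeasure π ∧ π (Set.Iio 0) = 0 ∧
      (∀ t ≤ (0 : ℝ), ∫ x, Fnu ν (t * x) ∂π = h t) ∧
      ∀ f : BoundedContinuousFunction ℝ ℝ,
        Tendsto (fun n => ∫ ω, f (X n ω) ∂(P n)) atTop (𝓝 (∫ x, f x ∂π)) := by
  have hX' (n : ℕ) : Measurable fun ω => (X n ω).toNNReal := (hX n).real_toNNReal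
  let μ : ℕ → ProbabilityMeasure NNReal := fun n =>
    ⟨(P n).map fun ω => (X n ω).toNNReal, Measure.isProbabilityMeasure_map (hX' n).aemeasurable⟩
  have hμ (n : ℕ) {g : ℝ → ℝ} (hg : Continuous g) :
      ∫ x : NNReal, g x ∂(μ n : Measure NNReal) = ∫ ω, g (X n ω) ∂(P n) := by
    change ∫ x : NNReal, g x ∂((P n).map fun ω => (X n ω).toNNReal) = _
    rw [integral_map (hX' n).aemeasurable
      (Continuous.aestronglyMeasurable (by fun_prop))]
    refine integral_congr_ae ?_
    filter_upwards [hXpos n] with ω hω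
    rw [Real.coe_toNNReal _ hω]
  have hF := continuous_Fnu hν
  have hconv' : ∀ t ≤ (0 : ℝ), Tendsto
      (fun n => ∫ x : NNReal, Fnu ν (t * x) ∂(μ n : Measure NNReal)) atTop (𝓝 (h t)) := by
    intro t ht
    refine (hconv t ht).congr fun n => ?_
    exact (hμ n (g := fun x => Fnu ν (t * x)) (by fun_prop)).symm
  obtain ⟨μ₀, hμ₀⟩ := exists_tendsto_of_tendsto_integral_Fnu hν hconv' hcont
  rw [ProbabilityMeasure.tendsto_iff_forall_integral_tendsto] at hμ₀
  have hcoe : Measurable ((↑) : NNReal → ℝ) := NNReal.continuous_coe.measurable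
  have hint {g : ℝ → ℝ} (hg : Continuous g) :
      ∫ x, g x ∂((μ₀ : Measure NNReal).map (↑)) = ∫ x : NNReal, g x ∂(μ₀ : Measure NNReal) :=
    integral_map hcoe.aemeasurable hg.aestronglyMeasurable
  refine ⟨(μ₀ : Measure NNReal).map (↑), Measure.isProbabilityMeasure_map hcoe.aemeasurable,
    ?_, fun t ht => ?_, fun f => ?_⟩
  · rw [Measure.map_apply hcoe measurableSet_Iio]
    convert measure_empty (μ := (μ₀ : Measure NNReal))
    ext x
    simp
  · rw [hint (by fun_prop)]
    refine tendsto_nhds_unique ?_ (hconv' t ht)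
    exact hμ₀ (BoundedContinuousFunction.ofNormedAddCommGroup
      (fun x : NNReal => Fnu ν (t * x)) (by fun_prop) 1
      fun x => abs_Fnu_le_one hν (mul_nonpos_of_nonpos_of_nonneg ht x.2))
  · rw [hint f.continuous]
    refine (hμ₀ (f.compContinuous ⟨_, NNReal.continuous_coe⟩)).congr fun n => ?_
    exact hμ n f.continuous
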